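/- Existence of second-price pacing equilibrium (SPPE): for every second-price pacing game with n bidders, m goods, values v_ij ≥ 0, and budgets B_i > 0, there exist pacing multipliers α_i ∈ [0,1] and a fractional allocation x_ij ∈ [0,1] with Σ_i x_ij = 1 for every good j, such that: (i) x_ij > 0 only if α_i v_ij = max_k α_k v_kj (only highest paced bidders are allocated); (ii) each bidder's spend s_i = Σ_j x_ij · (max_{k≠i} α_k v_kj) satisfies s_i ≤ B_i (budgets are respected); and (iii) no unnecessary pacing: if α_i < 1 then s_i = B_i. -/

import Mathlib

open Finset

/-- The highest competing paced bid against bidder `i`: the maximum of `f k` over `k ≠ i`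
(interpreted as `0` when there are no other bidders). -/
noncomputable def compMax (n : ℕ) (f : Fin n → ℝ) (i : Fin n) : ℝ :=
  ⨆ k ∈ Finset.univ.erase i, f k


/-- The vertex `q + 1_T` of the lattice cube based at `q`. -/
def kpt {n : ℕ} (q : Fin n → ℕ) (T : Finset (Fin n)) : Fin n → ℕ :=
  fun i => q i + if i ∈ T then 1 else 0

/-- The mod 2 cubical cochain `dL₀ ∪ ... ∪ dL_{k-1}`. -/
def kc {n : ℕ} (L : ℕ → (Fin n → ℕ) → ZMod 2) : ℕ → (Fin n → ℕ) → Finset (Fin n) → ZMod 2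
  | 0, _, _ => 1
  | k + 1, q, S => ∑ i ∈ S, kc L k q (S.erase i) * (L k (kpt q S) + L k (kpt q (S.erase i)))

lemma kpt_kpt {n : ℕ} (q : Fin n → ℕ) (S : Finset (Fin n)) (j : Fin n) (hj : j ∈ S) :
    kpt (kpt q {j}) (S.erase j) = kpt q S := by
  funext i
  simp only [kpt, Finset.mem_singleton, Finset.mem_erase]
  by_cases h : i = j
  · subst h; simp [hj]
  · simp [h]

lemma z2 (a : ZMod 2) : a + a = 0 := CharTwo.add_self_eq_zero a

lemma sum_symm_zero {ι : Type*} [DecidableEq ι] (S : Finset ι) (g : ι → ι → ZMod 2)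
    (hg : ∀ i j, g i j = g j i) : ∑ i ∈ S, ∑ j ∈ S.erase i, g i j = 0 := by
  rw [Finset.sum_sigma']
  refine Finset.sum_involution (fun x _ => ⟨x.2, x.1⟩) ?_ ?_ ?_ ?_
  · rintro ⟨i, j⟩ _
    simp only
    rw [hg i j]; exact z2 _
  · rintro ⟨i, j⟩ h _ he
    simp only [Finset.mem_sigma, Finset.mem_erase] at h
    simp only [Sigma.mk.injEq] at he
    exact h.2.1 he.1
  · rintro ⟨i, j⟩ h
    simp only [Finset.mem_sigma, Finset.mem_erase] at h ⊢
    exact ⟨h.2.2, fun e => h.2.1 e.symm, h.1⟩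
  · rintro ⟨i, j⟩ _
    rfl

lemma sum_erase_comm {ι : Type*} [DecidableEq ι] (S : Finset ι) (g : ι → ι → ZMod 2) :
    ∑ i ∈ S, ∑ j ∈ S.erase i, g i j = ∑ i ∈ S, ∑ j ∈ S.erase i, g j i := by
  refine Finset.sum_comm' ?_
  intro x y
  simp only [Finset.mem_erase]
  constructor
  · rintro ⟨a, b, c⟩; exact ⟨⟨fun e => b e.symm, a⟩, c⟩
  · rintro ⟨⟨a, b⟩, c⟩; exact ⟨b, fun e => a e.symm, c⟩

lemma kc_closed {n : ℕ} (L : ℕ → (Fin n → ℕ) → ZMod 2) (k : ℕ) :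
    ∀ (q : Fin n → ℕ) (S : Finset (Fin n)),
      ∑ j ∈ S, kc L k (kpt q {j}) (S.erase j) = ∑ j ∈ S, kc L k q (S.erase j) := by
  induction k with
  | zero => intro q S; rfl
  | succ k ih =>
    intro q S
    simp only [kc]
    have h1 : ∑ j ∈ S, ∑ i ∈ S.erase j, kc L k (kpt q {j}) ((S.erase j).erase i) *
          (L k (kpt (kpt q {j}) (S.erase j)) + L k (kpt (kpt q {j}) ((S.erase j).erase i)))
        = ∑ i ∈ S, ∑ j ∈ S.erase i, kc L k q ((S.erase i).erase j) *
          (L k (kpt q S) + L k (kpt q (S.erase i))) := by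
      rw [sum_erase_comm]
      refine Finset.sum_congr rfl fun i hi => ?_
      rw [← Finset.sum_mul, ← ih q (S.erase i), Finset.sum_mul]
      refine Finset.sum_congr rfl fun j hj => ?_
      have hj' := Finset.mem_erase.1 hj
      rw [kpt_kpt q S j hj'.2, Finset.erase_right_comm, kpt_kpt q (S.erase i) j hj]
    rw [h1, ← sub_eq_zero, ← Finset.sum_sub_distrib]
    simp only [← Finset.sum_sub_distrib]
    rw [← sum_symm_zero S (fun i j => kc L k q ((S.erase i).erase j) *
      (L k (kpt q S) + L k (kpt q ((S.erase i).erase j))))]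
    · refine Finset.sum_congr rfl fun i _ => Finset.sum_congr rfl fun j _ => ?_
      rw [CharTwo.sub_eq_add]
      linear_combination (kc L k q ((S.erase i).erase j)) * z2 (L k (kpt q (S.erase i)))
    · intro i j
      rw [Finset.erase_right_comm]

lemma kc_ne {n : ℕ} (L : ℕ → (Fin n → ℕ) → ZMod 2) (k : ℕ) :
    ∀ (q : Fin n → ℕ) (S : Finset (Fin n)), kc L k q S ≠ 0 →
      ∀ i < k, ∃ T U, T ⊆ S ∧ U ⊆ S ∧ L i (kpt q T) ≠ L i (kpt q U) := by
  induction k with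
  | zero => intro q S _ i hi; omega
  | succ k ih =>
    intro q S h i hi
    obtain ⟨j, hj, hne⟩ := Finset.exists_ne_zero_of_sum_ne_zero h
    have ha := left_ne_zero_of_mul hne
    have hb := right_ne_zero_of_mul hne
    rcases Nat.lt_succ_iff_lt_or_eq.1 hi with hi | rfl
    · obtain ⟨T, U, hT, hU, h⟩ := ih q _ ha i hi
      exact ⟨T, U, hT.trans (Finset.erase_subset _ _), hU.trans (Finset.erase_subset _ _), h⟩
    · refine ⟨S, S.erase j, le_rfl, Finset.erase_subset _ _, fun e => hb ?_⟩
      rw [e]; exact z2 _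

lemma sum_pi_update {n : ℕ} (t : Fin n → Finset ℕ) (i : Fin n) (s : Finset ℕ)
    (f : (Fin n → ℕ) → ZMod 2) :
    ∑ q ∈ Fintype.piFinset (Function.update t i s), f q =
      ∑ y ∈ s, ∑ q ∈ Fintype.piFinset (Function.update t i {0}), f (Function.update q i y) := by
  rw [← Finset.sum_product']
  refine Finset.sum_bij' (fun q _ => (q i, Function.update q i 0))
    (fun x _ => Function.update x.2 i x.1) ?_ ?_ ?_ ?_ ?_
  · intro q hq
    rw [Fintype.mem_piFinset] at hq
    rw [Finset.mem_product, Fintype.mem_piFinset]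
    refine ⟨by simpa using hq i, fun a => ?_⟩
    by_cases h : a = i
    · subst h; simp
    · simpa [h] using hq a
  · rintro ⟨y, q⟩ hq
    rw [Finset.mem_product, Fintype.mem_piFinset] at hq
    rw [Fintype.mem_piFinset]
    intro a
    by_cases h : a = i
    · subst h; simpa using hq.1
    · simpa [h] using hq.2 a
  · intro q _; simp
  · rintro ⟨y, q⟩ hq
    rw [Finset.mem_product, Fintype.mem_piFinset] at hq
    have : q i = 0 := by simpa using hq.2 i
    simp [← this]
  · intro q _; simp

lemma kpt_single {n : ℕ} (q : Fin n → ℕ) (i : Fin n) :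
    kpt q {i} = Function.update q i (q i + 1) := by
  funext a
  by_cases h : a = i
  · subst h; simp [kpt]
  · simp [kpt, h]

lemma sum_telescope {n : ℕ} (t : Fin n → Finset ℕ) (i : Fin n) (p : ℕ) (ht : t i = range p)
    (f : (Fin n → ℕ) → ZMod 2) :
    ∑ q ∈ Fintype.piFinset t, (f (kpt q {i}) + f q) =
      ∑ q ∈ Fintype.piFinset (Function.update t i {p}), f q +
      ∑ q ∈ Fintype.piFinset (Function.update t i {0}), f q := by
  have h0 : t = Function.update t i (range p) := by rw [← ht]; simp
  conv_lhs => rw [h0]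
  rw [sum_pi_update, sum_pi_update t i {p}, sum_pi_update t i {0} f]
  simp only [kpt_single, Function.update_self, Function.update_idem, Finset.sum_singleton]
  simp only [Finset.sum_add_distrib]
  set G : ℕ → ZMod 2 :=
    fun y => ∑ q ∈ Fintype.piFinset (Function.update t i {0}), f (Function.update q i y)
  change ∑ y ∈ range p, G (y + 1) + ∑ y ∈ range p, G y = G p + G 0
  have := Finset.sum_range_sub G p
  rw [Finset.sum_sub_distrib] at this
  simpa [CharTwo.sub_eq_add] using this

def kS (n k : ℕ) : Finset (Fin n) := univ.filter (fun i => i.val < k)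
def kA (n p k : ℕ) : Fin n → Finset ℕ := fun i => if i.val < k then range p else {p}

lemma kc_sum {n : ℕ} (p : ℕ) (L : ℕ → (Fin n → ℕ) → ZMod 2)
    (h0 : ∀ (i : Fin n) q, q i = 0 → L i q = 0) (hp : ∀ (i : Fin n) q, q i = p → L i q = 1)
    (k : ℕ) (hk : k ≤ n) :
    ∑ q ∈ Fintype.piFinset (kA n p k), kc L k q (kS n k) = 1 := by
  induction k with
  | zero => simp [kc, kA]
  | succ k ih =>
    have ih := ih (by omega)
    set S := kS n (k + 1) with hS
    let a : Fin n → (Fin n → ℕ) → ZMod 2 :=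
      fun i q => kc L k q (S.erase i) * L k (kpt q (S.erase i))
    have e1 : ∀ q, kc L (k + 1) q S = ∑ i ∈ S, (a i (kpt q {i}) + a i q) := by
      intro q
      simp only [kc, mul_add, Finset.sum_add_distrib, a]
      congr 1
      rw [← Finset.sum_mul, ← kc_closed, Finset.sum_mul]
      refine Finset.sum_congr rfl fun i hi => ?_
      rw [kpt_kpt q S i hi]
    simp only [e1]
    rw [Finset.sum_comm]
    have e2 : ∀ i ∈ S, ∑ q ∈ Fintype.piFinset (kA n p (k + 1)), (a i (kpt q {i}) + a i q) =
        ∑ q ∈ Fintype.piFinset (Function.update (kA n p (k + 1)) i {p}), a i q +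
        ∑ q ∈ Fintype.piFinset (Function.update (kA n p (k + 1)) i {0}), a i q := by
      intro i hi
      apply sum_telescope
      have : i.val < k + 1 := by simpa [hS, kS] using hi
      simp [kA, this]
    rw [Finset.sum_congr rfl e2]
    have hkpt : ∀ (q : Fin n → ℕ) (i : Fin n) (T : Finset (Fin n)), T ⊆ S.erase i →
        kpt q T i = q i := by
      intro q i T hT
      have : i ∉ T := fun h => by simpa using hT h
      simp [kpt, this]
    have hmem : ∀ (i : Fin n) (y : ℕ) q,
        q ∈ Fintype.piFinset (Function.update (kA n p (k + 1)) i {y}) → q i = y := by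
      intro i y q hq
      simpa using Fintype.mem_piFinset.1 hq i
    have hz : ∀ (i : Fin n) q, i.val < k → (q i = 0 ∨ q i = p) → a i q = 0 := by
      intro i q hi hq
      by_contra hne
      obtain ⟨T, U, hT, hU, h⟩ := kc_ne L k q _ (left_ne_zero_of_mul hne) i hi
      apply h
      rcases hq with hq | hq
      · rw [h0 i _ (by rw [hkpt q i T hT, hq]), h0 i _ (by rw [hkpt q i U hU, hq])]
      · rw [hp i _ (by rw [hkpt q i T hT, hq]), hp i _ (by rw [hkpt q i U hU, hq])]
    let κ : Fin n := ⟨k, by omega⟩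
    have hκ : κ ∈ S := by simp [hS, kS, κ]
    rw [Finset.sum_eq_single_of_mem κ hκ]
    · have hSe : S.erase κ = kS n k := by
        ext i
        simp only [hS, kS, Finset.mem_erase, Finset.mem_filter, Finset.mem_univ, true_and, κ,
          ne_eq, Fin.ext_iff]
        omega
      have hAe : Function.update (kA n p (k + 1)) κ {p} = kA n p k := by
        funext i
        by_cases h : i = κ
        · subst h; simp [kA, κ]
        · have h' : i.val ≠ k := fun e => h (Fin.ext e)
          have : (i.val < k + 1) ↔ i.val < k := by omega
          simp [h, kA, this]
      rw [Finset.sum_eq_zero (s := Fintype.piFinset (Function.update (kA n p (k + 1)) κ {0})),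
        add_zero, ← ih, hAe]
      · refine Finset.sum_congr rfl fun q hq => ?_
        rw [← hAe] at hq
        simp only [a]
        rw [hp κ (kpt q (S.erase κ)) (by rw [hkpt q κ _ le_rfl]; exact hmem κ p q hq), mul_one, hSe]
      · intro q hq
        simp only [a]
        rw [h0 κ (kpt q (S.erase κ)) (by rw [hkpt q κ _ le_rfl]; exact hmem κ 0 q hq), mul_zero]
    · intro i hi hne
      have h' : i.val ≠ k := fun e => hne (Fin.ext e)
      have hi' : i.val < k + 1 := by simpa [hS, kS] using hi
      rw [Finset.sum_eq_zero, Finset.sum_eq_zero, add_zero]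
      · intro q hq; exact hz i q (by omega) (Or.inl (hmem i 0 q hq))
      · intro q hq; exact hz i q (by omega) (Or.inr (hmem i p q hq))

/-- Kuhn's cubical lemma. -/
lemma kuhn {n : ℕ} (p : ℕ) (P : Fin n → (Fin n → ℕ) → Prop)
    (h0 : ∀ (i : Fin n) q, q i = 0 → ¬ P i q) (hp : ∀ (i : Fin n) q, q i = p → P i q) :
    ∃ q : Fin n → ℕ, (∀ i, q i < p) ∧ ∀ i, ∃ T U, P i (kpt q T) ∧ ¬ P i (kpt q U) := by
  classical
  let L : ℕ → (Fin n → ℕ) → ZMod 2 :=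
    fun k q => if h : k < n then (if P ⟨k, h⟩ q then 1 else 0) else 0
  have h := kc_sum p L (fun i q hq => by simp [L, h0 i q hq]) (fun i q hq => by simp [L, hp i q hq])
    n le_rfl
  obtain ⟨q, hq, hne⟩ := Finset.exists_ne_zero_of_sum_ne_zero (by rw [h]; exact one_ne_zero)
  refine ⟨q, fun i => by simpa [kA] using Fintype.mem_piFinset.1 hq i, fun i => ?_⟩
  obtain ⟨T, U, -, -, hTU⟩ := kc_ne L n q _ hne i i.2
  by_cases hT : P i (kpt q T) <;> by_cases hU : P i (kpt q U)
  · simp [L, hT, hU] at hTU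
  · exact ⟨T, U, hT, hU⟩
  · exact ⟨U, T, hU, hT⟩
  · simp [L, hT, hU] at hTU

lemma cube_compl {n : ℕ} (F : Fin n → (Fin n → ℝ) → ℝ) (hc : ∀ i, Continuous (F i))
    (hF : ∀ i, ∀ x ∈ Set.Icc (0 : Fin n → ℝ) 1, x i = 0 → 0 < F i x) :
    ∃ x ∈ Set.Icc (0 : Fin n → ℝ) 1, ∀ i, 0 ≤ F i x ∧ (x i < 1 → F i x = 0) := by
  have key : ∀ N : ℕ, ∃ y ∈ Set.Icc (0 : Fin n → ℝ) 1, ∃ t u : Fin n → Fin n → ℝ,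
      ∀ i, (∀ a, |t i a - y a| ≤ 1 / ((N : ℝ) + 1)) ∧ (∀ a, |u i a - y a| ≤ 1 / ((N : ℝ) + 1)) ∧
        (t i i = 1 ∨ F i (t i) ≤ 0) ∧ 0 ≤ F i (u i) := by
    intro N
    have hN : (0 : ℝ) < (N : ℝ) + 1 := by positivity
    let g : (Fin n → ℕ) → (Fin n → ℝ) := fun q a => (q a : ℝ) / ((N : ℝ) + 1)
    obtain ⟨q, hq, hTU⟩ := kuhn (n := n) (N + 1)
      (fun i q => q i = N + 1 ∨ (q i ≠ 0 ∧ F i (g q) ≤ 0))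
      (fun i q h => by simp [h]) (fun i q h => Or.inl h)
    choose T U hT hU using hTU
    have hcube : ∀ W, g (kpt q W) ∈ Set.Icc (0 : Fin n → ℝ) 1 := by
      intro W
      refine ⟨fun a => by simp only [g, Pi.zero_apply]; positivity, fun a => ?_⟩
      simp only [g, Pi.one_apply]
      rw [div_le_one hN]
      have : kpt q W a ≤ N + 1 := by
        have := hq a
        simp only [kpt]; split_ifs <;> omega
      exact_mod_cast this
    have hd : ∀ W a, |g (kpt q W) a - g q a| ≤ 1 / ((N : ℝ) + 1) := by
      intro W a
      simp only [g, kpt]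
      rw [← sub_div, abs_div, abs_of_pos hN]
      gcongr
      split_ifs <;> simp
    have hq0 : kpt q ∅ = q := by funext a; simp [kpt]
    refine ⟨g q, by simpa [hq0] using hcube ∅, fun i => g (kpt q (T i)), fun i => g (kpt q (U i)),
      fun i => ⟨hd _, hd _, ?_, ?_⟩⟩
    · rcases hT i with h | h
      · left
        simp only [g, h]
        push_cast
        exact div_self hN.ne'
      · exact Or.inr h.2
    · have h := hU i
      push Not at h
      by_cases h0 : kpt q (U i) i = 0
      · exact (hF i _ (hcube _) (by simp [g, h0])).le
      · exact (h.2 h0).le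
  choose y hy t u h using key
  obtain ⟨x, hx, φ, hφ, hlim⟩ := isCompact_Icc.tendsto_subseq hy
  have hclose : ∀ w : ℕ → Fin n → ℝ, (∀ N a, |w N a - y N a| ≤ 1 / ((N : ℝ) + 1)) →
      Filter.Tendsto (fun N => w (φ N)) Filter.atTop (nhds x) := by
    intro w hw
    rw [tendsto_pi_nhds] at hlim ⊢
    intro a
    have h1 : Filter.Tendsto (fun N : ℕ => w N a - y N a) Filter.atTop (nhds 0) :=
      squeeze_zero_norm (fun N => hw N a) tendsto_one_div_add_atTop_nhds_zero_nat
    have h2 := (h1.comp hφ.tendsto_atTop).add (hlim a)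
    simpa using h2
  refine ⟨x, hx, fun i => ?_⟩
  have ht := hclose (fun N => t N i) (fun N => (h N i).1)
  have hu := hclose (fun N => u N i) (fun N => (h N i).2.1)
  have hFu := ((hc i).tendsto x).comp hu
  have hFt := ((hc i).tendsto x).comp ht
  have hpos : 0 ≤ F i x := ge_of_tendsto' hFu fun N => (h (φ N) i).2.2.2
  refine ⟨hpos, fun hlt => le_antisymm ?_ hpos⟩
  refine le_of_tendsto hFt ?_
  have hev := ((tendsto_pi_nhds.1 ht) i).eventually (gt_mem_nhds hlt)
  filter_upwards [hev] with N hN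
  rcases (h (φ N) i).2.2.1 with h1 | h1
  · exact absurd h1 (ne_of_lt hN)
  · exact h1

lemma compMax_eq (n : ℕ) (f : Fin n → ℝ) (i : Fin n) :
    compMax n f i = ⨆ k, (if k = i then 0 else f k) := by
  unfold compMax
  congr 1
  funext k
  by_cases h : k = i
  · subst h; simp
  · simp [h]

lemma compMax_nonneg {n : ℕ} {f : Fin n → ℝ} (hf : ∀ k, 0 ≤ f k) (i : Fin n) :
    0 ≤ compMax n f i := by
  rw [compMax_eq]
  refine Real.iSup_nonneg fun k => ?_
  split_ifs
  · exact le_rfl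
  · exact hf k

lemma compMax_le {n : ℕ} {f : Fin n → ℝ} {M : ℝ} (hM : 0 ≤ M) (hf : ∀ k, f k ≤ M) (i : Fin n) :
    compMax n f i ≤ M := by
  rw [compMax_eq]
  refine Real.iSup_le (fun k => ?_) hM
  split_ifs
  · exact hM
  · exact hf k

lemma compMax_continuous (n : ℕ) (i : Fin n) : Continuous (fun f => compMax n f i) := by
  have hne : (univ : Finset (Fin n)).Nonempty := ⟨i, mem_univ i⟩
  have : Nonempty (Fin n) := ⟨i⟩
  have : (fun f => compMax n f i) =
      fun f => univ.sup' hne (fun k => if k = i then (0 : ℝ) else f k) := by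
    funext f
    rw [compMax_eq, Finset.sup'_univ_eq_ciSup]
  rw [this]
  refine Continuous.finset_sup'_apply hne fun k _ => ?_
  split_ifs
  · exact continuous_const
  · exact continuous_apply k

lemma approx_eq (n m : ℕ) (hn : 1 ≤ n)
    (v : Fin n → Fin m → ℝ) (B : Fin n → ℝ) (hv : ∀ i j, 0 ≤ v i j)
    (ε : ℝ) (hε : 0 < ε) (hB : ∀ i, m * ε < B i) :
    ∃ (α : Fin n → ℝ) (x : Fin n → Fin m → ℝ),
      (∀ i, 0 ≤ α i ∧ α i ≤ 1) ∧
      (∀ i j, 0 ≤ x i j ∧ x i j ≤ 1) ∧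
      (∀ j, ∑ i, x i j = 1) ∧
      (∀ i j, 0 < x i j → ∀ k, α k * v k j ≤ α i * v i j + ε) ∧
      (∀ i, ∑ j, x i j * compMax n (fun k => α k * v k j) i ≤ B i) ∧
      (∀ i, α i < 1 → ∑ j, x i j * compMax n (fun k => α k * v k j) i = B i) := by
  have hne : (univ : Finset (Fin n)).Nonempty := ⟨⟨0, hn⟩, mem_univ _⟩
  let M : (Fin n → ℝ) → Fin m → ℝ := fun α j => univ.sup' hne (fun k => α k * v k j)
  let w : (Fin n → ℝ) → Fin n → Fin m → ℝ := fun α i j => max 0 (α i * v i j - M α j + ε)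
  let D : (Fin n → ℝ) → Fin m → ℝ := fun α j => ∑ i, w α i j
  let x : (Fin n → ℝ) → Fin n → Fin m → ℝ := fun α i j => w α i j / D α j
  have hMle : ∀ α j k, α k * v k j ≤ M α j := fun α j k =>
    Finset.le_sup' (fun k => α k * v k j) (mem_univ k)
  have hw0 : ∀ α i j, 0 ≤ w α i j := fun α i j => le_max_left _ _
  have hD : ∀ α j, 0 < D α j := by
    intro α j
    obtain ⟨k, -, hk⟩ := Finset.exists_mem_eq_sup' hne (fun k => α k * v k j)
    refine Finset.sum_pos' (fun i _ => hw0 α i j) ⟨k, mem_univ k, ?_⟩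
    apply lt_max_of_lt_right
    have : M α j = α k * v k j := hk
    rw [this]; linarith
  have hMc : ∀ j, Continuous (fun α => M α j) := fun j =>
    Continuous.finset_sup'_apply hne fun k _ => by fun_prop
  have hwc : ∀ i j, Continuous (fun α => w α i j) := fun i j => by
    have := hMc j
    simp only [w]; fun_prop
  have hxc : ∀ i j, Continuous (fun α => x α i j) := fun i j =>
    (hwc i j).div (continuous_finsetSum _ fun k _ => hwc k j) (fun α => (hD α j).ne')
  have hpc : ∀ i j, Continuous (fun α : Fin n → ℝ => compMax n (fun k => α k * v k j) i) :=
    fun i j => (compMax_continuous n i).comp (by fun_prop)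
  have hx0 : ∀ α i j, 0 ≤ x α i j := fun α i j => div_nonneg (hw0 α i j) (hD α j).le
  have hx1 : ∀ α i j, x α i j ≤ 1 := fun α i j => by
    simp only [x]
    rw [div_le_one (hD α j)]
    exact Finset.single_le_sum (f := fun i => w α i j) (fun i _ => hw0 α i j) (mem_univ i)
  have hxpos : ∀ α i j, 0 < x α i j → M α j < α i * v i j + ε := by
    intro α i j h
    by_contra hcon
    have : w α i j = 0 := max_eq_left (by linarith)
    simp [x, this] at h
  obtain ⟨α, hα, hF⟩ := cube_compl
    (fun i α => B i - ∑ j, x α i j * compMax n (fun k => α k * v k j) i)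
    (fun i => continuous_const.sub (continuous_finsetSum _ fun j _ => (hxc i j).mul (hpc i j)))
    (by
      intro i α hα h0
      have hnn : ∀ k j, 0 ≤ α k * v k j := fun k j => mul_nonneg (hα.1 k) (hv k j)
      have : ∑ j, x α i j * compMax n (fun k => α k * v k j) i ≤ ∑ _j : Fin m, ε := by
        refine Finset.sum_le_sum fun j _ => ?_
        rcases (hx0 α i j).eq_or_lt with h | h
        · rw [← h, zero_mul]; exact hε.le
        · have h1 := hxpos α i j h
          rw [h0, zero_mul, zero_add] at h1
          have h2 : compMax n (fun k => α k * v k j) i ≤ ε :=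
            compMax_le hε.le (fun k => (hMle α j k).trans h1.le) i
          have h3 := compMax_nonneg (fun k => hnn k j) i
          nlinarith [hx1 α i j]
      rw [Finset.sum_const, Finset.card_univ, Fintype.card_fin, nsmul_eq_mul] at this
      linarith [hB i])
  refine ⟨α, x α, fun i => ⟨hα.1 i, hα.2 i⟩, fun i j => ⟨hx0 α i j, hx1 α i j⟩, ?_, ?_, ?_, ?_⟩
  · intro j
    simp only [x]
    rw [← Finset.sum_div]
    exact div_self (hD α j).ne'
  · intro i j h k
    exact (hMle α j k).trans (hxpos α i j h).le
  · intro i; linarith [(hF i).1]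
  · intro i h; linarith [(hF i).2 h]

/-- Existence of second-price pacing equilibrium (SPPE): every second-price pacing game
with budget-constrained bidders admits pacing multipliers in `[0,1]` and a fractional
allocation such that every good is fully allocated, only bidders with the highest paced
bid are allocated, budgets are respected, and any bidder pacing strictly below `1`
exactly exhausts its budget. -/
theorem sppe_exists
    (n m : ℕ) (hn : 1 ≤ n)
    (v : Fin n → Fin m → ℝ) (B : Fin n → ℝ)
    (hv : ∀ i j, 0 ≤ v i j) (hB : ∀ i, 0 < B i) :
    ∃ (α : Fin n → ℝ) (x : Fin n → Fin m → ℝ),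
      (∀ i, 0 ≤ α i ∧ α i ≤ 1) ∧
      (∀ i j, 0 ≤ x i j ∧ x i j ≤ 1) ∧
      (∀ j, ∑ i, x i j = 1) ∧
      (∀ i j, 0 < x i j → ∀ k, α k * v k j ≤ α i * v i j) ∧
      (∀ i, ∑ j, x i j * compMax n (fun k => α k * v k j) i ≤ B i) ∧
      (∀ i, α i < 1 → ∑ j, x i j * compMax n (fun k => α k * v k j) i = B i) := by
  have hne : (univ : Finset (Fin n)).Nonempty := ⟨⟨0, hn⟩, mem_univ _⟩
  obtain ⟨b, -, hb⟩ := Finset.exists_min_image univ B hne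
  have hm : (0 : ℝ) < (m : ℝ) + 1 := by positivity
  let ε : ℕ → ℝ := fun N => B b / ((m : ℝ) + 1) * (1 / ((N : ℝ) + 1))
  have hε : ∀ N, 0 < ε N := fun N => by
    have := hB b
    simp only [ε]; positivity
  have hε0 : Filter.Tendsto ε Filter.atTop (nhds 0) := by
    simpa [ε] using (tendsto_one_div_add_atTop_nhds_zero_nat (𝕜 := ℝ)).const_mul (B b / ((m : ℝ) + 1))
  have hεB : ∀ N i, m * ε N < B i := by
    intro N i
    have h1 : ε N ≤ B b / ((m : ℝ) + 1) := by
      have h2 : 1 / ((N : ℝ) + 1) ≤ 1 := by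
        rw [div_le_one (by positivity)]; linarith [Nat.cast_nonneg (α := ℝ) N]
      exact mul_le_of_le_one_right (div_pos (hB b) hm).le h2
    have h3 : (m + 1) * ε N ≤ B b := by
      rw [le_div_iff₀ hm] at h1; linarith
    linarith [hb i (mem_univ i), hε N]
  choose α x h1 h2 h3 h4 h5 h6 using fun N => approx_eq n m hn v B hv (ε N) (hε N) (hεB N)
  have hmem : ∀ N, (α N, x N) ∈
      Set.Icc (0 : Fin n → ℝ) 1 ×ˢ Set.Icc (0 : Fin n → Fin m → ℝ) 1 := fun N =>
    ⟨⟨fun i => (h1 N i).1, fun i => (h1 N i).2⟩,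
      ⟨fun i j => (h2 N i j).1, fun i j => (h2 N i j).2⟩⟩
  obtain ⟨⟨a, y⟩, hay, φ, hφ, hlim⟩ := (isCompact_Icc.prod isCompact_Icc).tendsto_subseq hmem
  have hεφ := hε0.comp hφ.tendsto_atTop
  have hla : ∀ i, Filter.Tendsto (fun N => α (φ N) i) Filter.atTop (nhds (a i)) :=
    tendsto_pi_nhds.1 ((continuous_fst.tendsto _).comp hlim)
  have hly : ∀ i j, Filter.Tendsto (fun N => x (φ N) i j) Filter.atTop (nhds (y i j)) := fun i =>
    tendsto_pi_nhds.1 (tendsto_pi_nhds.1 ((continuous_snd.tendsto _).comp hlim) i)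
  have hls : ∀ i, Filter.Tendsto
      (fun N => ∑ j, x (φ N) i j * compMax n (fun k => α (φ N) k * v k j) i) Filter.atTop
      (nhds (∑ j, y i j * compMax n (fun k => a k * v k j) i)) := by
    intro i
    refine tendsto_finsetSum _ fun j _ => (hly i j).mul ?_
    exact ((compMax_continuous n i).tendsto (fun k => a k * v k j)).comp
      (tendsto_pi_nhds.2 fun k => (hla k).mul_const _)
  refine ⟨a, y, fun i => ⟨hay.1.1 i, hay.1.2 i⟩, fun i j => ⟨hay.2.1 i j, hay.2.2 i j⟩,
    ?_, ?_, ?_, ?_⟩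
  · intro j
    refine tendsto_nhds_unique (tendsto_finsetSum _ fun i _ => hly i j) ?_
    simp only [h3]
    exact tendsto_const_nhds
  · intro i j hpos k
    have hev := (hly i j).eventually (lt_mem_nhds hpos)
    have hr := ((hla i).mul_const (v i j)).add hεφ
    rw [add_zero] at hr
    refine le_of_tendsto_of_tendsto ((hla k).mul_const (v k j)) hr ?_
    filter_upwards [hev] with N hN
    exact h4 (φ N) i j hN k
  · intro i
    exact le_of_tendsto' (hls i) fun N => h5 (φ N) i
  · intro i hi
    refine tendsto_nhds_unique (hls i) ?_
    have hev := (hla i).eventually (gt_mem_nhds hi)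
    refine tendsto_const_nhds.congr' ?_
    filter_upwards [hev] with N hN
    exact (h6 (φ N) i hN).symm
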